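/- arXiv:2502.10605 — 4 statements merged into one kernel-verified Lean document; each statement's English description precedes it below -/
import Mathlib

section
/- Let μ be a σ-finite measure on a measurable space 𝒳, and let f, g : 𝒳 → ℝ be measurable with f ≥ 0 and g > 0 μ-a.e., such that S := ∫ √(f·g) dμ satisfies 0 < S < ∞. Fix B > 0 and define π*(x) := B·√(f(x)/g(x))/S. Then ∫ g·π* dμ = B, ∫ f/π* dμ = S²/B, and for every measurable π : 𝒳 → ℝ with π > 0 μ-a.e. and ∫ g·π dμ ≤ B, one has ∫ f/π dμ ≥ S²/B. -/
open MeasureTheory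

/-- Pointwise weighted AM-GM inequality behind the Cauchy–Schwarz bound. -/
lemma two_mul_sqrt_mul_le_div_add_sq_mul {a b p : ℝ} (ha : 0 ≤ a) (hb : 0 ≤ b) (hp : 0 < p)
    (t : ℝ) : 2 * t * √(a * b) ≤ a / p + t ^ 2 * (b * p) := by
  have hsq : √(a * b) = √(a / p) * √(b * p) := by
    rw [← Real.sqrt_mul (by positivity)]
    congr 1
    field_simp
  have h₁ := Real.sq_sqrt (show 0 ≤ a / p by positivity)
  have h₂ := Real.sq_sqrt (show 0 ≤ b * p by positivity)
  rw [hsq, ← h₁, ← h₂, Real.sqrt_sq (Real.sqrt_nonneg _), Real.sqrt_sq (Real.sqrt_nonneg _)]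
  linarith [sq_nonneg (√(a / p) - t * √(b * p))]

lemma mul_sqrt_div_self {a b : ℝ} (hb : 0 < b) : b * √(a / b) = √(a * b) := by
  rw [show a * b = b ^ 2 * (a / b) by field_simp, Real.sqrt_mul (sq_nonneg b),
    Real.sqrt_sq hb.le]

lemma div_sqrt_div_self {a : ℝ} (ha : 0 ≤ a) (b : ℝ) : a / √(a / b) = √(a * b) := by
  rw [Real.sqrt_div ha, Real.sqrt_mul ha, div_div_eq_mul_div, mul_div_right_comm, Real.div_sqrt]

/-- Optimal annotation probabilities under a budget constraint: the common
variational core. Minimizing `∫ f/π dμ` subject to `∫ g·π dμ ≤ B` over positive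
measurable `π` is achieved at `π* = B·√(f/g)/S` with `S = ∫ √(f·g) dμ`, and the
optimal value is `S²/B`. -/
theorem optimal_sampling_global_core
    {𝒳 : Type*} [MeasurableSpace 𝒳] (μ : Measure 𝒳) [SigmaFinite μ]
    (f g : 𝒳 → ℝ) (hf : Measurable f) (hg : Measurable g)
    (hf0 : ∀ᵐ x ∂μ, 0 ≤ f x) (hg0 : ∀ᵐ x ∂μ, 0 < g x)
    (hfin : Integrable (fun x => Real.sqrt (f x * g x)) μ)
    (S : ℝ) (hS : S = ∫ x, Real.sqrt (f x * g x) ∂μ) (hSpos : 0 < S)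
    (B : ℝ) (hB : 0 < B)
    (πstar : 𝒳 → ℝ) (hπstar : πstar = fun x => B * Real.sqrt (f x / g x) / S) :
    (∫⁻ x, ENNReal.ofReal (g x * πstar x) ∂μ = ENNReal.ofReal B) ∧
    (∫⁻ x, ENNReal.ofReal (f x / πstar x) ∂μ = ENNReal.ofReal (S ^ 2 / B)) ∧
    (∀ π : 𝒳 → ℝ, Measurable π → (∀ᵐ x ∂μ, 0 < π x) →
      ∫⁻ x, ENNReal.ofReal (g x * π x) ∂μ ≤ ENNReal.ofReal B →
      ENNReal.ofReal (S ^ 2 / B) ≤ ∫⁻ x, ENNReal.ofReal (f x / π x) ∂μ) := by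
  have hint (c : ℝ) (hc : 0 ≤ c) :
      ∫⁻ x, ENNReal.ofReal (c * √(f x * g x)) ∂μ = ENNReal.ofReal (c * S) := by
    rw [← ofReal_integral_eq_lintegral_ofReal (hfin.const_mul c)
      (.of_forall fun x => mul_nonneg hc (Real.sqrt_nonneg _)), integral_const_mul, hS]
  subst hπstar
  refine ⟨?_, ?_, fun π hπ hπ0 hbudget => ?_⟩
  · rw [show B = B / S * S by field_simp, ← hint (B / S) (by positivity)]
    refine lintegral_congr_ae ?_
    filter_upwards [hg0] with x hgx
    rw [← mul_sqrt_div_self hgx]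
    congr 1
    field_simp
  · rw [show S ^ 2 / B = S / B * S by ring, ← hint (S / B) (by positivity)]
    refine lintegral_congr_ae ?_
    filter_upwards [hf0] with x hfx
    rw [← div_sqrt_div_self hfx]
    congr 1
    simp only [div_eq_mul_inv, mul_inv, inv_inv]
    ring
  · refine (ENNReal.add_le_add_iff_right (ENNReal.ofReal_ne_top (r := S ^ 2 / B))).1 ?_
    calc ENNReal.ofReal (S ^ 2 / B) + ENNReal.ofReal (S ^ 2 / B)
        = ∫⁻ x, ENNReal.ofReal (2 * (S / B) * √(f x * g x)) ∂μ := by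
          rw [hint _ (by positivity), ← ENNReal.ofReal_add (by positivity) (by positivity)]
          congr 1
          ring
      _ ≤ ∫⁻ x, (ENNReal.ofReal (f x / π x)
            + ENNReal.ofReal ((S / B) ^ 2) * ENNReal.ofReal (g x * π x)) ∂μ := by
          refine lintegral_mono_ae ?_
          filter_upwards [hf0, hg0, hπ0] with x hfx hgx hπx
          rw [← ENNReal.ofReal_mul (by positivity),
            ← ENNReal.ofReal_add (by positivity) (by positivity)]
          exact ENNReal.ofReal_le_ofReal
            (two_mul_sqrt_mul_le_div_add_sq_mul hfx hgx.le hπx _)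
      _ = ∫⁻ x, ENNReal.ofReal (f x / π x) ∂μ
            + ENNReal.ofReal ((S / B) ^ 2) * ∫⁻ x, ENNReal.ofReal (g x * π x) ∂μ := by
          rw [lintegral_add_left (by fun_prop),
            lintegral_const_mul _ (by fun_prop)]
      _ ≤ ∫⁻ x, ENNReal.ofReal (f x / π x) ∂μ
            + ENNReal.ofReal ((S / B) ^ 2) * ENNReal.ofReal B := by gcongr
      _ = ∫⁻ x, ENNReal.ofReal (f x / π x) ∂μ + ENNReal.ofReal (S ^ 2 / B) := by
          rw [← ENNReal.ofReal_mul (by positivity)]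
          congr 2
          field_simp
end

section
/- Let μ be a probability measure on a measurable space 𝒳 (the covariate distribution). Let σ₁², σ₀² : 𝒳 → ℝ be measurable and nonnegative, let e₁ : 𝒳 → (0,1) be measurable and set e₀ := 1 − e₁. Assume C := ∫ (√σ₁² + √σ₀²) dμ satisfies 0 < C < ∞, and fix a budget B > 0. Define π*(z,x) := B·√(σ_z²(x)) / (e_z(x)·C) for z ∈ {0,1}. Then: (i) ∫ (π*(1,·)·e₁ + π*(0,·)·e₀) dμ = B; (ii) Σ_{z∈{0,1}} ∫ σ_z²/(e_z·π*(z,·)) dμ = C²/B; and (iii) for every pair of measurable functions π(1,·), π(0,·) : 𝒳 → ℝ with π(z,·) > 0 μ-a.e. and ∫ (π(1,·)·e₁ + π(0,·)·e₀) dμ ≤ B, one has Σ_{z∈{0,1}} ∫ σ_z²/(e_z·π(z,·)) dμ ≥ C²/B. -/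
open MeasureTheory

/-- Weighted AM-GM: the tangent-line lower bound for `s / p` at the point `√s / k`. -/
theorem two_mul_sqrt_le_div_add {s p : ℝ} (k : ℝ) (hs : 0 ≤ s) (hp : 0 < p) :
    2 * k * √s ≤ s / p + k ^ 2 * p := by
  have h : s / p + k ^ 2 * p - 2 * k * √s = (√s - k * p) ^ 2 / p := by
    rw [sub_sq, Real.sq_sqrt hs]
    field_simp
    ring
  have : 0 ≤ (√s - k * p) ^ 2 / p := by positivity
  linarith

/-- With `π = B √s / (e C)`, the quotient `s / (e π)` is proportional to `√s`. -/
theorem div_mul_optimal_eq {s e B C : ℝ} (he : e ≠ 0) :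
    s / (e * (B * √s / (e * C))) = C / B * √s := by
  have h : e * (B * √s / (e * C)) = B / C * √s := by
    field_simp
  rw [h, div_mul_eq_div_div_swap, Real.div_sqrt, div_div_eq_mul_div]
  ring

/-- Optimal annotation probabilities under a global budget (Theorem on the
global budget problem): `π*(z,x) = B·√(σ_z²(x))/(e_z(x)·C)` with
`C = ∫ (√σ₁² + √σ₀²) dμ` satisfies the budget with equality, attains objective
value `C²/B`, and any feasible `π` has objective value at least `C²/B`. -/
theorem optimal_sampling_global_budget
    {𝒳 : Type*} [MeasurableSpace 𝒳] (μ : Measure 𝒳) [IsProbabilityMeasure μ]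
    (s1 s0 e1 : 𝒳 → ℝ)
    (hs1m : Measurable s1) (hs0m : Measurable s0)
    (hs1 : ∀ x, 0 ≤ s1 x) (hs0 : ∀ x, 0 ≤ s0 x)
    (he1m : Measurable e1) (he1 : ∀ x, e1 x ∈ Set.Ioo (0 : ℝ) 1)
    (hfin : Integrable (fun x => Real.sqrt (s1 x) + Real.sqrt (s0 x)) μ)
    (C : ℝ) (hC : C = ∫ x, (Real.sqrt (s1 x) + Real.sqrt (s0 x)) ∂μ) (hCpos : 0 < C)
    (B : ℝ) (hB : 0 < B)
    (π1star π0star : 𝒳 → ℝ)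
    (hπ1star : π1star = fun x => B * Real.sqrt (s1 x) / (e1 x * C))
    (hπ0star : π0star = fun x => B * Real.sqrt (s0 x) / ((1 - e1 x) * C)) :
    (∫⁻ x, ENNReal.ofReal (π1star x * e1 x + π0star x * (1 - e1 x)) ∂μ
        = ENNReal.ofReal B) ∧
    (∫⁻ x, ENNReal.ofReal (s1 x / (e1 x * π1star x)) ∂μ
        + ∫⁻ x, ENNReal.ofReal (s0 x / ((1 - e1 x) * π0star x)) ∂μ
        = ENNReal.ofReal (C ^ 2 / B)) ∧
    (∀ π1 π0 : 𝒳 → ℝ, Measurable π1 → Measurable π0 →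
      (∀ᵐ x ∂μ, 0 < π1 x) → (∀ᵐ x ∂μ, 0 < π0 x) →
      ∫⁻ x, ENNReal.ofReal (π1 x * e1 x + π0 x * (1 - e1 x)) ∂μ ≤ ENNReal.ofReal B →
      ENNReal.ofReal (C ^ 2 / B) ≤
        ∫⁻ x, ENNReal.ofReal (s1 x / (e1 x * π1 x)) ∂μ
          + ∫⁻ x, ENNReal.ofReal (s0 x / ((1 - e1 x) * π0 x)) ∂μ) := by
  have he (x) : 0 < e1 x := (he1 x).1
  have he' (x) : 0 < 1 - e1 x := sub_pos.2 (he1 x).2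
  have key (k : ℝ) (hk : 0 ≤ k) :
      ∫⁻ x, ENNReal.ofReal (k * (√(s1 x) + √(s0 x))) ∂μ = ENNReal.ofReal (k * C) := by
    rw [hC, ← integral_const_mul]
    exact (ofReal_integral_eq_lintegral_ofReal (hfin.const_mul k)
      (ae_of_all _ fun x => by positivity)).symm
  refine ⟨?_, ?_, fun π1 π0 hπ1m hπ0m hπ1 hπ0 hbudget => ?_⟩
  · rw [← div_mul_cancel₀ B hCpos.ne', ← key (B / C) (by positivity)]
    refine lintegral_congr fun x => ?_
    have := (he x).ne'
    have := (he' x).ne'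
    simp only [hπ1star, hπ0star]
    congr 1
    field_simp
  · rw [← lintegral_add_left (by subst hπ1star; fun_prop),
      show C ^ 2 / B = C / B * C by ring, ← key (C / B) (by positivity)]
    refine lintegral_congr fun x => ?_
    simp only [hπ1star, hπ0star]
    rw [div_mul_optimal_eq (he x).ne', div_mul_optimal_eq (he' x).ne',
      ← ENNReal.ofReal_add (by positivity) (by positivity), mul_add]
  · rw [← lintegral_add_left (by fun_prop)]
    refine (ENNReal.add_le_add_iff_right (ENNReal.ofReal_ne_top (r := C ^ 2 / B))).1 ?_
    calc ENNReal.ofReal (C ^ 2 / B) + ENNReal.ofReal (C ^ 2 / B)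
        = ∫⁻ x, ENNReal.ofReal (2 * (C / B) * (√(s1 x) + √(s0 x))) ∂μ := by
          rw [key _ (by positivity), ← ENNReal.ofReal_add (by positivity) (by positivity)]
          congr 1
          ring
      _ ≤ ∫⁻ x, (ENNReal.ofReal (s1 x / (e1 x * π1 x))
            + ENNReal.ofReal (s0 x / ((1 - e1 x) * π0 x))
            + ENNReal.ofReal ((C / B) ^ 2)
              * ENNReal.ofReal (π1 x * e1 x + π0 x * (1 - e1 x))) ∂μ := by
          refine lintegral_mono_ae ?_
          filter_upwards [hπ1, hπ0] with x h1 h0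
          have p1 := mul_pos (he x) h1
          have p0 := mul_pos (he' x) h0
          have q1 := div_nonneg (hs1 x) p1.le
          have q0 := div_nonneg (hs0 x) p0.le
          rw [← ENNReal.ofReal_mul (by positivity), ← ENNReal.ofReal_add q1 q0,
            ← ENNReal.ofReal_add (add_nonneg q1 q0)
              (mul_nonneg (by positivity) (by linarith))]
          refine ENNReal.ofReal_le_ofReal ?_
          linear_combination two_mul_sqrt_le_div_add (C / B) (hs1 x) p1
            + two_mul_sqrt_le_div_add (C / B) (hs0 x) p0
      _ ≤ _ := by
          rw [lintegral_add_left (by fun_prop), lintegral_const_mul _ (by fun_prop)]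
          gcongr
          refine (mul_le_mul_right hbudget _).trans_eq ?_
          rw [← ENNReal.ofReal_mul (by positivity)]
          congr 1
          field_simp
end

section
/- Let μ be a probability measure on a measurable space 𝒳, let f : 𝒳 → ℝ be measurable and nonnegative, and let e : 𝒳 → (0,1) be measurable with ∫ e dμ > 0. Assume 0 < ∫ √f dμ < ∞, and fix B_z > 0. Define π*(x) := B_z·(√f(x)/e(x))·(∫ e dμ)/(∫ √f dμ). Then: (i) ∫ π*·e dμ = B_z·∫ e dμ, i.e. the conditional budget constraint holds with equality; (ii) ∫ f/(e·π*) dμ = (∫ √f dμ)² / (B_z·∫ e dμ); and (iii) for every measurable π : 𝒳 → ℝ with π > 0 μ-a.e. and ∫ π·e dμ ≤ B_z·∫ e dμ, one has ∫ f/(e·π) dμ ≥ (∫ √f dμ)² / (B_z·∫ e dμ). -/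
open MeasureTheory

/-- The lower integral of a nonnegative multiple of a nonnegative integrable function. -/
lemma lintegral_ofReal_const_mul {α : Type*} [MeasurableSpace α] {μ : Measure α} {s : α → ℝ}
    (hs : ∀ x, 0 ≤ s x) (hint : Integrable s μ) {c : ℝ} (hc : 0 ≤ c) :
    ∫⁻ x, ENNReal.ofReal (c * s x) ∂μ = ENNReal.ofReal (c * ∫ x, s x ∂μ) := by
  rw [← integral_const_mul, ofReal_integral_eq_lintegral_ofReal (hint.const_mul c)
    (ae_of_all _ fun x => mul_nonneg hc (hs x))]

/-- The Cauchy–Schwarz (Sedrakyan) inequality `(∫ s)² / M ≤ ∫ s² / g` for a weight `g` of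
total mass at most `M`. -/
lemma sq_integral_div_le_lintegral_sq_div {α : Type*} [MeasurableSpace α] {μ : Measure α}
    {s g : α → ℝ} (hs : ∀ x, 0 ≤ s x) (hint : Integrable s μ) (hg : Measurable g)
    (hgpos : ∀ᵐ x ∂μ, 0 < g x) {M : ℝ} (hM : 0 < M)
    (hgM : ∫⁻ x, ENNReal.ofReal (g x) ∂μ ≤ ENNReal.ofReal M) :
    ENNReal.ofReal ((∫ x, s x ∂μ) ^ 2 / M) ≤ ∫⁻ x, ENNReal.ofReal (s x ^ 2 / g x) ∂μ := by
  have hS : 0 ≤ ∫ x, s x ∂μ := integral_nonneg hs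
  set S := ∫ x, s x ∂μ
  set c := S / M with hc
  have hc0 : 0 ≤ c := by positivity
  have tangent : ∀ᵐ x ∂μ, ENNReal.ofReal (2 * c * s x) ≤
      ENNReal.ofReal (s x ^ 2 / g x) + ENNReal.ofReal (c ^ 2) * ENNReal.ofReal (g x) := by
    filter_upwards [hgpos] with x hx
    rw [← ENNReal.ofReal_mul (by positivity), ← ENNReal.ofReal_add (by positivity) (by positivity)]
    apply ENNReal.ofReal_le_ofReal
    have hsq : s x ^ 2 / g x + c ^ 2 * g x - 2 * c * s x = (s x - c * g x) ^ 2 / g x := by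
      field_simp
      ring
    have : 0 ≤ (s x - c * g x) ^ 2 / g x := by positivity
    linarith
  have hsum : ENNReal.ofReal (S ^ 2 / M) + ENNReal.ofReal (c ^ 2 * M) ≤
      ∫⁻ x, ENNReal.ofReal (s x ^ 2 / g x) ∂μ + ENNReal.ofReal (c ^ 2 * M) := calc
    _ = ENNReal.ofReal (2 * c * S) := by
      rw [← ENNReal.ofReal_add (by positivity) (by positivity)]
      congr 1
      rw [hc]
      field_simp
      ring
    _ = ∫⁻ x, ENNReal.ofReal (2 * c * s x) ∂μ :=
      (lintegral_ofReal_const_mul hs hint (by positivity)).symm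
    _ ≤ _ := lintegral_mono_ae tangent
    _ = ∫⁻ x, ENNReal.ofReal (s x ^ 2 / g x) ∂μ +
        ENNReal.ofReal (c ^ 2) * ∫⁻ x, ENNReal.ofReal (g x) ∂μ := by
      rw [lintegral_add_right _ (hg.ennreal_ofReal.const_mul _),
        lintegral_const_mul _ hg.ennreal_ofReal]
    _ ≤ _ := by
      rw [ENNReal.ofReal_mul (by positivity : 0 ≤ c ^ 2)]
      gcongr
  exact (ENNReal.add_le_add_iff_right ENNReal.ofReal_ne_top).1 hsum

/-- Optimal annotation probabilities under a treatment-arm-specific budget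
(Theorem on the within-z-budget problem): `π*(x) = B_z·(√f(x)/e(x))·(∫e dμ)/(∫√f dμ)`
satisfies the conditional budget constraint with equality, attains objective
value `(∫√f dμ)²/(B_z·∫e dμ)`, and any feasible `π` does at least as badly. -/
theorem optimal_sampling_z_budget
    {𝒳 : Type*} [MeasurableSpace 𝒳] (μ : Measure 𝒳) [IsProbabilityMeasure μ]
    (f e : 𝒳 → ℝ) (hfm : Measurable f) (hf : ∀ x, 0 ≤ f x)
    (hem : Measurable e) (he : ∀ x, e x ∈ Set.Ioo (0 : ℝ) 1)
    (hepos : 0 < ∫ x, e x ∂μ)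
    (hfin : Integrable (fun x => Real.sqrt (f x)) μ)
    (hpos : 0 < ∫ x, Real.sqrt (f x) ∂μ)
    (Bz : ℝ) (hBz : 0 < Bz)
    (πstar : 𝒳 → ℝ)
    (hπstar : πstar = fun x =>
      Bz * (Real.sqrt (f x) / e x) * (∫ x', e x' ∂μ) / (∫ x', Real.sqrt (f x') ∂μ)) :
    (∫⁻ x, ENNReal.ofReal (πstar x * e x) ∂μ
        = ENNReal.ofReal (Bz * ∫ x, e x ∂μ)) ∧
    (∫⁻ x, ENNReal.ofReal (f x / (e x * πstar x)) ∂μ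
        = ENNReal.ofReal ((∫ x, Real.sqrt (f x) ∂μ) ^ 2 / (Bz * ∫ x, e x ∂μ))) ∧
    (∀ π : 𝒳 → ℝ, Measurable π → (∀ᵐ x ∂μ, 0 < π x) →
      ∫⁻ x, ENNReal.ofReal (π x * e x) ∂μ ≤ ENNReal.ofReal (Bz * ∫ x, e x ∂μ) →
      ENNReal.ofReal ((∫ x, Real.sqrt (f x) ∂μ) ^ 2 / (Bz * ∫ x, e x ∂μ)) ≤
        ∫⁻ x, ENNReal.ofReal (f x / (e x * π x)) ∂μ) := by
  subst hπstar
  have hs : ∀ x, 0 ≤ √(f x) := fun x => Real.sqrt_nonneg _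
  set S := ∫ x, √(f x) ∂μ
  set E := ∫ x, e x ∂μ
  refine ⟨?_, ?_, fun π hπm hπ hbudget => ?_⟩
  · have hpt : ∀ x, Bz * (√(f x) / e x) * E / S * e x = Bz * E / S * √(f x) := fun x => by
      have := (he x).1
      field_simp
    simp_rw [hpt]
    rw [lintegral_ofReal_const_mul hs hfin (by positivity), div_mul_cancel₀ _ hpos.ne']
  · have hpt : ∀ x, f x / (e x * (Bz * (√(f x) / e x) * E / S)) = S / (Bz * E) * √(f x) :=
      fun x => by
      have := (he x).1
      rcases (hs x).eq_or_lt with h0 | h0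
      · simp [← h0]
      · field_simp
        rw [Real.sq_sqrt (hf x)]
    simp_rw [hpt]
    rw [lintegral_ofReal_const_mul hs hfin (by positivity)]
    congr 1
    ring
  · have hgpos : ∀ᵐ x ∂μ, 0 < π x * e x := hπ.mono fun x hx => mul_pos hx (he x).1
    simpa only [Real.sq_sqrt (hf _), Pi.mul_apply, mul_comm (π _)] using
      sq_integral_div_le_lintegral_sq_div hs hfin (hπm.mul hem) hgpos (mul_pos hBz hepos) hbudget
end

section
/- Let μ be a probability measure on a measurable space 𝒳, let σ₁², σ₀² : 𝒳 → ℝ be measurable, nonnegative and μ-integrable with σ_z²/e_z μ-integrable, and let e₁ : 𝒳 → (0,1) be measurable with e₀ := 1 − e₁. Then (∫ (√σ₁² + √σ₀²) dμ)² ≤ ∫ (σ₁²/e₁ + σ₀²/e₀) dμ. -/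
open MeasureTheory

/-- Two-term Sedrakyan inequality with weights summing to one, in square-root form. -/
lemma sq_sqrt_add_sqrt_le_div_add_div {a b t : ℝ} (ha : 0 ≤ a) (hb : 0 ≤ b)
    (ht : t ∈ Set.Ioo (0 : ℝ) 1) :
    (Real.sqrt a + Real.sqrt b) ^ 2 ≤ a / t + b / (1 - t) := by
  have ht0 : 0 < t := ht.1
  have ht1 : 0 < 1 - t := sub_pos.mpr ht.2
  rw [div_add_div _ _ ht0.ne' ht1.ne', le_div_iff₀ (mul_pos ht0 ht1)]
  nlinarith [sq_nonneg (Real.sqrt a * (1 - t) - Real.sqrt b * t), Real.sq_sqrt ha,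
    Real.sq_sqrt hb]

/-- Jensen's inequality for the square, with an integrable majorant of `f ^ 2`. -/
lemma sq_integral_le_integral_of_sq_le {α : Type*} [MeasurableSpace α] {μ : Measure α}
    [IsProbabilityMeasure μ] {f g : α → ℝ} (hf : Integrable f μ) (hg : Integrable g μ)
    (hfg : ∀ x, f x ^ 2 ≤ g x) :
    (∫ x, f x ∂μ) ^ 2 ≤ ∫ x, g x ∂μ := by
  set c := ∫ x, f x ∂μ with hc
  have hlin : Integrable (fun x => 2 * c * f x) μ := hf.const_mul _
  calc c ^ 2 = ∫ x, (2 * c * f x - c ^ 2) ∂μ := by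
        rw [integral_sub hlin (integrable_const _), integral_const_mul, ← hc]
        simp
        ring
    _ ≤ ∫ x, g x ∂μ :=
        integral_mono (hlin.sub (integrable_const _)) hg fun x => by
          nlinarith [hfg x, sq_nonneg (f x - c)]

lemma integrable_sqrt {α : Type*} [MeasurableSpace α] {μ : Measure α} [IsFiniteMeasure μ]
    {f : α → ℝ} (hf : Integrable f μ) (hf0 : ∀ x, 0 ≤ f x) :
    Integrable (fun x => Real.sqrt (f x)) μ := by
  refine ((integrable_const (1 : ℝ)).add hf).mono'
    (Real.continuous_sqrt.comp_aestronglyMeasurable hf.aestronglyMeasurable)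
    (Filter.Eventually.of_forall fun x => ?_)
  rw [Real.norm_of_nonneg (Real.sqrt_nonneg _)]
  change Real.sqrt (f x) ≤ 1 + f x
  nlinarith [Real.sq_sqrt (hf0 x), sq_nonneg (Real.sqrt (f x) - 1), hf0 x]

/-- Key inequality behind the relative-efficiency corollary:
`(∫ (√σ₁² + √σ₀²) dμ)² ≤ ∫ (σ₁²/e₁ + σ₀²/e₀) dμ` with `e₀ = 1 − e₁`. -/
theorem optimized_vs_uniform_inequality
    {𝒳 : Type*} [MeasurableSpace 𝒳] (μ : Measure 𝒳) [IsProbabilityMeasure μ]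
    (s1 s0 e1 : 𝒳 → ℝ)
    (hs1m : Measurable s1) (hs0m : Measurable s0)
    (hs1 : ∀ x, 0 ≤ s1 x) (hs0 : ∀ x, 0 ≤ s0 x)
    (hs1i : Integrable s1 μ) (hs0i : Integrable s0 μ)
    (he1m : Measurable e1) (he1 : ∀ x, e1 x ∈ Set.Ioo (0 : ℝ) 1)
    (hs1e : Integrable (fun x => s1 x / e1 x) μ)
    (hs0e : Integrable (fun x => s0 x / (1 - e1 x)) μ) :
    (∫ x, (Real.sqrt (s1 x) + Real.sqrt (s0 x)) ∂μ) ^ 2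
      ≤ ∫ x, (s1 x / e1 x + s0 x / (1 - e1 x)) ∂μ := by
  exact sq_integral_le_integral_of_sq_le
    ((integrable_sqrt hs1i hs1).add (integrable_sqrt hs0i hs0)) (hs1e.add hs0e)
    fun x => sq_sqrt_add_sqrt_le_div_add_div (hs1 x) (hs0 x) (he1 x)
end
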